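/- Let Y(t), t ∈ [0,T], be a separable Gaussian random process with ε₀ := sup_{0≤t≤T} (E|Y(t)|²)^{1/2} < ∞ and sup_{|t−s|≤ε, t,s∈[0,T]} (E|Y(t) − Y(s)|²)^{1/2} ≤ σ(ε) := C / (ln(e^α + 1/ε))^β, for some β > 1/2, α > 0, C > 0. Then for every u > 8δ(ε₀): P{ sup_{0≤t≤T} |Y(t)| > u } ≤ 2 exp{ −(u − √(8u δ(ε₀)))² / (2ε₀²) }, where ν = min(ε₀, σ(T/2)) and δ(ε₀) = (ν/√2) ( √(ln(T+1)) + (1 − 1/(2β))^{−1} (C/ν)^{1/(2β)} ). -/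

import Mathlib

open MeasureTheory Filter

/-- A real-valued process is Gaussian if all of its finite-dimensional distributions are
Gaussian, i.e. every finite linear combination of its values is a (possibly degenerate)
Gaussian random variable. -/
def IsGaussianProcess {Ω : Type*} [MeasurableSpace Ω] (P : Measure Ω)
    (X : ℝ → Ω → ℝ) : Prop :=
  ∀ (n : ℕ) (t : Fin n → ℝ) (a : Fin n → ℝ), ∃ (m : ℝ) (v : NNReal),
    Measure.map (fun ω => ∑ i, a i * X (t i) ω) P = ProbabilityTheory.gaussianReal m v

/-- Doob separability of a real-valued process on a set `I ⊆ ℝ` (w.r.t. the metric `|t-s|`). -/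
def DoobSeparableOn {Ω : Type*} [MeasurableSpace Ω] (P : Measure Ω)
    (X : ℝ → Ω → ℝ) (I : Set ℝ) : Prop :=
  ∃ S : Set ℝ, S.Countable ∧ S ⊆ I ∧
    ∀ᵐ ω ∂P, ∀ t ∈ I, ∀ ε > 0,
      X t ω ∈ closure ((fun s => X s ω) '' (S ∩ Set.Ioo (t - ε) (t + ε)))

lemma aux_exp_le_cosh (x : ℝ) : Real.exp |x| ≤ 2 * Real.cosh x := by
  rw [← Real.cosh_abs x, Real.cosh_eq]
  have := Real.exp_pos (-|x|)
  linarith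

/-- Jensen with sub-unit total mass. -/
lemma aux_jensen {K : ℕ} (p x : ℕ → ℝ) (hp : ∀ k, 0 ≤ p k)
    (hsum : ∑ k ∈ Finset.range K, p k ≤ 1) :
    Real.exp (∑ k ∈ Finset.range K, p k * x k) ≤
      ∑ k ∈ Finset.range K, p k * Real.exp (x k) + (1 - ∑ k ∈ Finset.range K, p k) := by
  set y := ∑ k ∈ Finset.range K, p k * x k with hy
  set Q := ∑ k ∈ Finset.range K, p k with hQ
  have tang : ∀ z : ℝ, Real.exp y * (1 + z - y) ≤ Real.exp z := by
    intro z
    have h1 := Real.add_one_le_exp (z - y)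
    have h2 : Real.exp z = Real.exp y * Real.exp (z - y) := by
      rw [← Real.exp_add]; congr 1; ring
    rw [h2]
    exact mul_le_mul_of_nonneg_left (by linarith) (Real.exp_pos y).le
  have h1 : ∑ k ∈ Finset.range K, p k * (Real.exp y * (1 + x k - y)) ≤
      ∑ k ∈ Finset.range K, p k * Real.exp (x k) :=
    Finset.sum_le_sum fun k _ => mul_le_mul_of_nonneg_left (tang _) (hp k)
  have h2 : ∑ k ∈ Finset.range K, p k * (Real.exp y * (1 + x k - y)) =
      Real.exp y * (Q + y - Q * y) := by
    have : ∀ k ∈ Finset.range K, p k * (Real.exp y * (1 + x k - y)) =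
      Real.exp y * (p k * (1 - y) + p k * x k) := fun k _ => by ring
    rw [Finset.sum_congr rfl this, ← Finset.mul_sum, Finset.sum_add_distrib, ← Finset.sum_mul,
      ← hy, ← hQ]
    ring
  have h3 := mul_le_mul_of_nonneg_left (tang 0) (sub_nonneg.2 hsum)
  rw [Real.exp_zero] at h3
  nlinarith

lemma aux_chain {Ω : Type*} [MeasurableSpace Ω] (P : Measure Ω) [IsProbabilityMeasure P]
    (K : ℕ) (Z : ℕ → ℝ → Ω → ℝ) (A : ℕ → Finset ℝ) (p w b H : ℕ → ℝ) (l u : ℝ) (hl : 0 ≤ l)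
    (hp : ∀ k, 0 ≤ p k) (hsum : ∑ k ∈ Finset.range K, p k ≤ 1) (hpw : ∀ k, p k * w k = l)
    (hw : ∀ k, 0 ≤ w k)
    (hint : ∀ k < K, ∀ s ∈ A k, Integrable (fun ω => Real.cosh (w k * Z k s ω)) P ∧
      ∫ ω, Real.cosh (w k * Z k s ω) ∂P ≤ Real.exp (b k ^ 2 / 2))
    (hcard : ∀ k < K, ((A k).card : ℝ) ≤ Real.exp (H k)) (E : Set Ω)
    (hE : ∀ ω ∈ E, ∃ s : ℕ → ℝ, (∀ k < K, s k ∈ A k) ∧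
      u ≤ ∑ k ∈ Finset.range K, |Z k (s k) ω|) :
    P.real E ≤ 2 * Real.exp (∑ k ∈ Finset.range K, p k * (H k + b k ^ 2 / 2) - l * u) := by
  set G := ∑ k ∈ Finset.range K, p k * (H k + b k ^ 2 / 2) with hG
  set W : Ω → ℝ := fun ω => ∑ k ∈ Finset.range K, p k * (∑ s ∈ A k,
    Real.cosh (w k * Z k s ω) * Real.exp (-H k - b k ^ 2 / 2)) +
      (1 - ∑ k ∈ Finset.range K, p k) with hW
  have hWint1 : Integrable (fun ω => ∑ k ∈ Finset.range K, p k * (∑ s ∈ A k,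
    Real.cosh (w k * Z k s ω) * Real.exp (-H k - b k ^ 2 / 2))) P := by
    refine integrable_finsetSum _ fun k hk => Integrable.const_mul ?_ _
    refine integrable_finsetSum _ fun s hs => Integrable.mul_const ?_ _
    exact (hint k (Finset.mem_range.1 hk) s hs).1
  have hWint : Integrable W P := hWint1.add (integrable_const _)
  have hW0 : ∀ ω, 0 ≤ W ω := by
    intro ω
    refine add_nonneg (Finset.sum_nonneg fun k _ => mul_nonneg (hp k) (Finset.sum_nonneg
      fun s _ => mul_nonneg (Real.cosh_pos _).le (Real.exp_pos _).le)) (by linarith)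
  have hWle : ∫ ω, W ω ∂P ≤ 1 := by
    rw [hW, integral_add hWint1 (integrable_const _)]
    rw [integral_finsetSum _ fun k hk => Integrable.const_mul (integrable_finsetSum _
      fun s hs => Integrable.mul_const (hint k (Finset.mem_range.1 hk) s hs).1 _) _]
    have : ∀ k ∈ Finset.range K, ∫ ω, p k * (∑ s ∈ A k,
        Real.cosh (w k * Z k s ω) * Real.exp (-H k - b k ^ 2 / 2)) ∂P ≤ p k := by
      intro k hk
      rw [integral_const_mul, integral_finsetSum _ fun s hs =>
        Integrable.mul_const (hint k (Finset.mem_range.1 hk) s hs).1 _]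
      refine mul_le_of_le_one_right (hp k) ?_
      calc _ ≤ ∑ s ∈ A k, Real.exp (-H k) := by
            refine Finset.sum_le_sum fun s hs => ?_
            rw [integral_mul_const]
            calc _ ≤ Real.exp (b k ^ 2 / 2) * Real.exp (-H k - b k ^ 2 / 2) :=
                  mul_le_mul_of_nonneg_right (hint k (Finset.mem_range.1 hk) s hs).2
                    (Real.exp_pos _).le
              _ = _ := by rw [← Real.exp_add]; congr 1; ring
        _ = (A k).card * Real.exp (-H k) := by simp
        _ ≤ Real.exp (H k) * Real.exp (-H k) :=
            mul_le_mul_of_nonneg_right (hcard k (Finset.mem_range.1 hk)) (Real.exp_pos _).le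
        _ = 1 := by rw [← Real.exp_add]; simp
    have := Finset.sum_le_sum this
    simp only [integral_const, probReal_univ, one_smul]
    linarith
  have hsub : E ⊆ {ω | Real.exp (l * u - G) / 2 ≤ W ω} := by
    intro ω hω
    obtain ⟨s, hs, hu⟩ := hE ω hω
    have hJ := aux_jensen (K := K) p
      (fun k => w k * |Z k (s k) ω| - Real.log 2 - H k - b k ^ 2 / 2) hp hsum
    have e1 : ∑ k ∈ Finset.range K, p k * (w k * |Z k (s k) ω| - Real.log 2 - H k - b k ^ 2 / 2)
        = l * ∑ k ∈ Finset.range K, |Z k (s k) ω| - Real.log 2 * ∑ k ∈ Finset.range K, p k - G := by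
      rw [hG, Finset.mul_sum, Finset.mul_sum, ← Finset.sum_sub_distrib, ← Finset.sum_sub_distrib]
      refine Finset.sum_congr rfl fun k _ => ?_
      rw [← hpw k]; ring
    rw [e1] at hJ
    have h2 : l * u - G - Real.log 2 ≤ l * ∑ k ∈ Finset.range K, |Z k (s k) ω| -
        Real.log 2 * ∑ k ∈ Finset.range K, p k - G := by
      have := mul_le_mul_of_nonneg_left hu hl
      have := mul_le_of_le_one_right (Real.log_pos one_lt_two).le hsum
      linarith
    have h3 : Real.exp (l * u - G) / 2 = Real.exp (l * u - G - Real.log 2) := by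
      rw [Real.exp_sub _ (Real.log 2), Real.exp_log two_pos]
    show _ ≤ W ω
    rw [h3]
    refine (Real.exp_le_exp.2 h2).trans (hJ.trans ?_)
    refine add_le_add (Finset.sum_le_sum fun k hk => mul_le_mul_of_nonneg_left ?_ (hp k)) le_rfl
    refine le_trans ?_ (Finset.single_le_sum (f := fun s => Real.cosh (w k * Z k s ω) *
      Real.exp (-H k - b k ^ 2 / 2)) (fun s _ => mul_nonneg (Real.cosh_pos _).le
        (Real.exp_pos _).le) (hs k (Finset.mem_range.1 hk)))
    have h4 := aux_exp_le_cosh (w k * Z k (s k) ω)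
    rw [abs_mul, abs_of_nonneg (hw k)] at h4
    have h5 : Real.exp (w k * |Z k (s k) ω| - Real.log 2 - H k - b k ^ 2 / 2) =
        Real.exp (w k * |Z k (s k) ω|) / 2 * Real.exp (-H k - b k ^ 2 / 2) := by
      rw [show w k * |Z k (s k) ω| - Real.log 2 - H k - b k ^ 2 / 2 =
        (w k * |Z k (s k) ω| - Real.log 2) + (- H k - b k ^ 2 / 2) by ring, Real.exp_add,
        Real.exp_sub _ (Real.log 2), Real.exp_log two_pos]
    rw [h5]
    exact mul_le_mul_of_nonneg_right (by linarith) (Real.exp_pos _).le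
  have hM := mul_meas_ge_le_integral_of_nonneg (ae_of_all P hW0) hWint (Real.exp (l * u - G) / 2)
  have hmono : P.real E ≤ P.real {ω | Real.exp (l * u - G) / 2 ≤ W ω} := measureReal_mono hsub
  have hpos := Real.exp_pos (l * u - G)
  have h6 : Real.exp (G - l * u) = (Real.exp (l * u - G))⁻¹ := by
    rw [← Real.exp_neg]; congr 1; ring
  rw [h6]
  have h7 : Real.exp (l * u - G) / 2 * P.real E ≤ 1 :=
    (mul_le_mul_of_nonneg_left hmono (by positivity)).trans (hM.trans hWle)
  rw [← div_eq_mul_inv, le_div_iff₀ hpos]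
  linarith

lemma aux_gauss {Ω : Type*} [MeasurableSpace Ω] (P : Measure Ω) [IsProbabilityMeasure P]
    (X : Ω → ℝ) (m : ℝ) (v : NNReal) (hX : Measure.map X P = ProbabilityTheory.gaussianReal m v)
    (d w : ℝ) (hd : Real.sqrt (∫ ω, (X ω) ^ 2 ∂P) ≤ d) :
    Integrable (fun ω => Real.cosh (w * X ω)) P ∧
      ∫ ω, Real.cosh (w * X ω) ∂P ≤ Real.exp ((w * d) ^ 2 / 2) := by
  have hm : AEMeasurable X P := by
    apply AEMeasurable.of_map_ne_zero
    rw [hX]; exact IsProbabilityMeasure.ne_zero _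
  have hI : ∀ t : ℝ, Integrable (fun ω => Real.exp (t * X ω)) P := by
    intro t
    have := ProbabilityTheory.integrable_exp_mul_gaussianReal (μ := m) (v := v) t
    rw [← hX] at this
    exact this.comp_aemeasurable hm
  have hE : ∀ t : ℝ, ∫ ω, Real.exp (t * X ω) ∂P = Real.exp (m * t + v * t ^ 2 / 2) :=
    fun t => ProbabilityTheory.mgf_gaussianReal hX t
  have h2 : ∫ ω, (X ω) ^ 2 ∂P = m ^ 2 + v := by
    have h := ProbabilityTheory.variance_eq_sub
      (ProbabilityTheory.memLp_id_gaussianReal (μ := m) (v := v) 2)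
    rw [ProbabilityTheory.variance_id_gaussianReal] at h
    simp only [id, Pi.pow_apply, ProbabilityTheory.integral_id_gaussianReal] at h
    rw [← hX, integral_map hm (by fun_prop)] at h
    linarith
  have hfun : (fun ω => Real.cosh (w * X ω)) =
      fun ω => (Real.exp (w * X ω) + Real.exp (-w * X ω)) / 2 := by
    ext ω; rw [Real.cosh_eq, neg_mul]
  rw [hfun]
  refine ⟨((hI w).add (hI (-w))).div_const 2, ?_⟩
  rw [integral_div, integral_add (hI w) (hI (-w)), hE, hE]
  have h3 : (Real.exp (m * w + v * w ^ 2 / 2) + Real.exp (m * -w + v * (-w) ^ 2 / 2)) / 2 =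
      Real.cosh (m * w) * Real.exp (v * w ^ 2 / 2) := by
    rw [Real.cosh_eq, Real.exp_add, Real.exp_add]
    rw [mul_neg, neg_sq]; ring
  rw [h3]
  have h4 : m ^ 2 + v ≤ d ^ 2 := by
    rw [← h2]
    exact (Real.sqrt_le_left ((Real.sqrt_nonneg _).trans hd)).1 hd
  calc _ ≤ Real.exp ((m * w) ^ 2 / 2) * Real.exp (v * w ^ 2 / 2) :=
        mul_le_mul_of_nonneg_right (Real.cosh_le_exp_half_sq _) (Real.exp_pos _).le
    _ = Real.exp ((m ^ 2 + v) * w ^ 2 / 2) := by rw [← Real.exp_add]; congr 1; ring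
    _ ≤ _ := by
      apply Real.exp_le_exp.2
      have := mul_le_mul_of_nonneg_right h4 (sq_nonneg w)
      nlinarith

/-- Concavity increment for `x ^ (1-g)`. -/
lemma aux_concave (g x y : ℝ) (hg : 0 < g) (hg1 : g < 1) (hx : 0 < x) (hxy : x ≤ y) :
    (y - x) * y ^ (-g) ≤ (1 - g)⁻¹ * y ^ (1 - g) - (1 - g)⁻¹ * x ^ (1 - g) := by
  have hy : 0 < y := hx.trans_le hxy
  have h := rpow_one_add_le_one_add_mul_self (s := x / y - 1) (p := 1 - g)
    (by have := div_pos hx hy; linarith) (by linarith) (by linarith)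
  rw [add_sub_cancel, Real.div_rpow hx.le hy.le] at h
  have hyp : 0 < y ^ (1 - g) := Real.rpow_pos_of_pos hy _
  have e : y ^ (1 - g) = y * y ^ (-g) := by
    rw [sub_eq_add_neg, Real.rpow_add hy, Real.rpow_one]
  rw [div_le_iff₀ hyp] at h
  have h2 : (1 + (1 - g) * (x / y - 1)) * y ^ (1 - g) =
      y ^ (1 - g) + (1 - g) * ((x - y) * y ^ (-g)) := by
    rw [e]; field_simp
  rw [h2] at h
  have : 0 < 1 - g := by linarith
  rw [← mul_sub, inv_mul_eq_div, le_div_iff₀ this]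
  linarith

lemma aux_net (T : ℝ) (hT : 0 < T) (D : ℝ → ℝ → ℝ) (C α β : ℝ) (hC : 0 < C) (hα : 0 < α)
    (hβ : 1 / 2 < β)
    (hmod : ∀ ε : ℝ, 0 < ε → ∀ t ∈ Set.Icc (0 : ℝ) T, ∀ s ∈ Set.Icc (0 : ℝ) T,
      |t - s| ≤ ε → D t s ≤ C / (Real.log (Real.exp α + 1 / ε)) ^ β)
    (ν e : ℝ) (he : 0 < e) (hν : ν ≤ C / (Real.log (Real.exp α + 1 / (T / 2))) ^ β)
    (hνe : ν < e → C / (Real.log (Real.exp α + 1 / (T / 2))) ^ β ≤ e) :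
    ∃ (S : Finset ℝ) (π : ℝ → ℝ), S.Nonempty ∧ (∀ s ∈ S, s ∈ Set.Icc 0 T) ∧
      (∀ t ∈ Set.Icc 0 T, π t ∈ S ∧ D t (π t) ≤ e) ∧
      Real.sqrt (Real.log S.card) ≤
        if e ≤ ν then Real.sqrt (Real.log (T + 1)) + (C / e) ^ (1 / (2 * β)) else 0 := by
  have hβ0 : 0 < β := by linarith
  by_cases hc : e ≤ ν
  · rw [if_pos hc]
    have heS := hc.trans hν
    set L := Real.log (Real.exp α + 1 / (T / 2)) with hL
    have hLα : α < L := by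
      rw [hL, Real.lt_log_iff_exp_lt (by positivity)]
      have : 0 < 1 / (T / 2) := by positivity
      linarith
    have hL0 : 0 < L := hα.trans hLα
    set M := (C / e) ^ (1 / β) with hM
    have hM0 : 0 ≤ M := by positivity
    have hML : L ≤ M := by
      have h1 : L ^ β ≤ C / e := by
        rw [le_div_iff₀ he]
        rw [le_div_iff₀ (by positivity)] at heS
        linarith
      have h2 := Real.rpow_le_rpow (by positivity) h1 (z := 1 / β) (by positivity)
      rwa [← Real.rpow_mul hL0.le, mul_one_div_cancel hβ0.ne', Real.rpow_one] at h2
    have hX : 0 < Real.exp M - Real.exp α := by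
      rw [sub_pos]; exact Real.exp_lt_exp.2 (by linarith)
    set X := Real.exp M - Real.exp α with hXdef
    set v := 1 / X with hv
    have hv0 : 0 < v := by positivity
    have hσ : C / (Real.log (Real.exp α + 1 / v)) ^ β = e := by
      rw [hv, one_div_one_div, hXdef, add_sub_cancel, Real.log_exp, hM,
        ← Real.rpow_mul (by positivity), one_div_mul_cancel hβ0.ne', Real.rpow_one]
      field_simp
    refine ⟨(Finset.range (⌊T / v⌋₊ + 1)).image (fun i : ℕ => (i : ℝ) * v),
      fun t => (⌊t / v⌋₊ : ℝ) * v, by simp, ?_, ?_, ?_⟩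
    · intro s hs
      simp only [Finset.mem_image, Finset.mem_range] at hs
      obtain ⟨i, hi, rfl⟩ := hs
      refine ⟨by positivity, ?_⟩
      have h1 : (i : ℝ) ≤ T / v :=
        (Nat.le_floor_iff (by positivity)).1 (Nat.lt_succ_iff.1 hi)
      rwa [le_div_iff₀ hv0] at h1
    · intro t ht
      have h1 : (⌊t / v⌋₊ : ℝ) ≤ t / v := Nat.floor_le (div_nonneg ht.1 hv0.le)
      have h2 : t / v < (⌊t / v⌋₊ : ℝ) + 1 := Nat.lt_floor_add_one _
      rw [le_div_iff₀ hv0] at h1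
      rw [div_lt_iff₀ hv0] at h2
      have hmono : ⌊t / v⌋₊ ≤ ⌊T / v⌋₊ :=
        Nat.floor_le_floor (div_le_div_of_nonneg_right ht.2 hv0.le)
      refine ⟨Finset.mem_image.2 ⟨_, Finset.mem_range.2 (Nat.lt_succ_of_le hmono), rfl⟩, ?_⟩
      rw [← hσ]
      refine hmod v hv0 t ht _ ⟨by positivity, h1.trans ht.2⟩ ?_
      rw [abs_le]; constructor <;> nlinarith
    · set N := ((Finset.range (⌊T / v⌋₊ + 1)).image (fun i : ℕ => (i : ℝ) * v)).card with hN
      have hNpos : 0 < N := Finset.card_pos.2 (by simp)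
      have hN1 : (N : ℝ) ≤ T / v + 1 := by
        have h1 : N ≤ ⌊T / v⌋₊ + 1 := Finset.card_image_le.trans (by simp)
        have h2 : (N : ℝ) ≤ ⌊T / v⌋₊ + 1 := by exact_mod_cast h1
        have := Nat.floor_le (a := T / v) (by positivity)
        linarith
      have hN2 : (N : ℝ) ≤ (T + 1) * Real.exp M := by
        have h1 : T / v = T * X := by rw [hv]; field_simp
        have h2 : 1 ≤ Real.exp M := Real.one_le_exp hM0
        have h3 : T * X ≤ T * Real.exp M :=
          mul_le_mul_of_nonneg_left (by have := Real.exp_pos α; linarith) hT.le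
        rw [h1] at hN1
        linarith
      have hlog : Real.log N ≤ Real.log (T + 1) + M := by
        have := Real.log_le_log (by exact_mod_cast hNpos) hN2
        rwa [Real.log_mul (by positivity) (Real.exp_pos _).ne', Real.log_exp] at this
      have hl0 : 0 ≤ Real.log (T + 1) := Real.log_nonneg (by linarith)
      have hMsq : M = ((C / e) ^ (1 / (2 * β))) ^ 2 := by
        rw [← Real.rpow_natCast, ← Real.rpow_mul (by positivity), hM]
        congr 1; push_cast; field_simp
      have hR : 0 ≤ (C / e) ^ (1 / (2 * β)) := by positivity
      apply Real.sqrt_le_iff.2 ⟨by positivity, ?_⟩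
      have hs := Real.sq_sqrt hl0
      have := mul_nonneg (Real.sqrt_nonneg (Real.log (T + 1))) hR
      nlinarith
  · rw [if_neg hc]
    refine ⟨{T / 2}, fun _ => T / 2, by simp, ?_, ?_, by simp⟩
    · intro s hs
      rw [Finset.mem_singleton] at hs
      subst hs; constructor <;> linarith
    · intro t ht
      refine ⟨by simp, (hmod (T / 2) (by positivity) t ht (T / 2)
        ⟨by linarith, by linarith⟩ ?_).trans (hνe (not_le.1 hc))⟩
      rw [abs_le]; constructor <;> linarith [ht.1, ht.2]

lemma aux_path {Ω : Type*} (T : ℝ) (Y : ℝ → Ω → ℝ) (S : ℕ → Finset ℝ) (π : ℕ → ℝ → ℝ)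
    (hS : ∀ k, ∀ s ∈ S k, s ∈ Set.Icc 0 T) (hπ : ∀ k, ∀ t ∈ Set.Icc 0 T, π k t ∈ S k) (n : ℕ) :
    ∀ t ∈ Set.Icc 0 T, ∃ s : ℕ → ℝ, s n = t ∧ (∀ k < n, s k ∈ S (k + 1)) ∧
      ∀ ω, Y t ω = ∑ k ∈ Finset.range (n + 1),
        (if k = 0 then Y (s k) ω else Y (s k) ω - Y (π k (s k)) ω) := by
  induction n with
  | zero => intro t _; exact ⟨fun _ => t, rfl, by simp, by simp⟩
  | succ n ih =>
    intro t ht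
    have hm := hπ (n + 1) t ht
    obtain ⟨s, h1, h2, h3⟩ := ih (π (n + 1) t) (hS _ _ hm)
    refine ⟨Function.update s (n + 1) t, by simp, ?_, ?_⟩
    · intro k hk
      rw [Function.update_of_ne (by omega)]
      rcases Nat.lt_succ_iff_lt_or_eq.1 hk with h | h
      · exact h2 k h
      · subst h; rw [h1]; exact hm
    · intro ω
      rw [Finset.sum_range_succ]
      have : ∑ k ∈ Finset.range (n + 1), (if k = 0 then Y (Function.update s (n + 1) t k) ω
          else Y (Function.update s (n + 1) t k) ω - Y (π k (Function.update s (n + 1) t k)) ω)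
          = Y (π (n + 1) t) ω := by
        rw [h3 ω]
        refine Finset.sum_congr rfl fun k hk => ?_
        rw [Function.update_of_ne (by have := Finset.mem_range.1 hk; omega)]
      rw [this]
      simp

lemma aux_core {Ω : Type*} [MeasurableSpace Ω] (P : Measure Ω) [IsProbabilityMeasure P]
    (T : ℝ) (Y : ℝ → Ω → ℝ) (hgauss : IsGaussianProcess P Y)
    (S : ℕ → Finset ℝ) (π : ℕ → ℝ → ℝ) (ε₀ θ l u B : ℝ) (hε : 0 < ε₀) (hθ : 0 < θ) (hθ1 : θ < 1)
    (hl : 0 < l) (hne : ∀ k, (S k).Nonempty)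
    (hS : ∀ k, ∀ s ∈ S k, s ∈ Set.Icc 0 T) (hπ : ∀ k, ∀ t ∈ Set.Icc 0 T, π k t ∈ S k)
    (h0 : ∀ t ∈ Set.Icc 0 T, Real.sqrt (∫ ω, (Y t ω) ^ 2 ∂P) ≤ ε₀)
    (hD : ∀ k, ∀ t ∈ Set.Icc 0 T,
      Real.sqrt (∫ ω, (Y t ω - Y (π k t) ω) ^ 2 ∂P) ≤ ε₀ * θ ^ k)
    (F : Finset ℝ) (hF : ∀ t ∈ F, t ∈ Set.Icc 0 T) (hFne : F.Nonempty) (K : ℕ)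
    (hB : ∑ k ∈ Finset.range K, ε₀ * θ ^ k * Real.sqrt (Real.log (S (k + 1)).card) ≤ B) :
    P.real {ω | ∃ t ∈ F, u < |Y t ω|} ≤ 2 * Real.exp (l ^ 2 * ε₀ ^ 2 / (2 * (1 - θ) ^ 2) +
      Real.sqrt 2 * l * B - l * u + l * (ε₀ * Real.sqrt (2 * Real.log F.card)) * θ ^ K) := by
  have hθ' : 0 < 1 - θ := by linarith
  set A : ℕ → Finset ℝ := fun k => if k < K then S (k + 1) else F with hA
  have hAne : ∀ k, (A k).Nonempty := by
    intro k; simp only [hA]; split_ifs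
    · exact hne _
    · exact hFne
  have hAI : ∀ k, ∀ s ∈ A k, s ∈ Set.Icc 0 T := by
    intro k; simp only [hA]; split_ifs
    · exact hS _
    · exact hF
  set H : ℕ → ℝ := fun k => Real.log (A k).card with hH
  have hcpos : ∀ k, (1 : ℝ) ≤ (A k).card := fun k => by
    exact_mod_cast Finset.card_pos.2 (hAne k)
  have hH0 : ∀ k, 0 ≤ H k := fun k => Real.log_nonneg (hcpos k)
  set a := l * ε₀ / (1 - θ) with ha
  have ha0 : 0 < a := by positivity
  set b : ℕ → ℝ := fun k => max (Real.sqrt (2 * H k)) a with hb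
  have hb0 : ∀ k, 0 < b k := fun k => ha0.trans_le (le_max_right _ _)
  set d : ℕ → ℝ := fun k => ε₀ * θ ^ k with hd
  have hd0 : ∀ k, 0 < d k := fun k => by positivity
  set Z : ℕ → ℝ → Ω → ℝ := fun k s ω => if k = 0 then Y s ω else Y s ω - Y (π k s) ω with hZ
  have hgeo : ∀ n, (1 - θ) * ∑ k ∈ Finset.range n, θ ^ k ≤ 1 := by
    intro n
    rw [mul_neg_geom_sum]
    have : 0 < θ ^ n := by positivity
    linarith
  have hdsum : ∑ k ∈ Finset.range (K + 1), d k ≤ ε₀ / (1 - θ) := by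
    rw [hd, ← Finset.mul_sum, le_div_iff₀ hθ']
    nlinarith [hgeo (K + 1)]
  have key := aux_chain P (K + 1) Z A (fun k => l * d k / b k) (fun k => b k / d k) b H l u hl.le
    (fun k => (div_pos (mul_pos hl (hd0 k)) (hb0 k)).le) ?_ ?_
    (fun k => (div_pos (hb0 k) (hd0 k)).le) ?_ ?_ {ω | ∃ t ∈ F, u < |Y t ω|} ?_
  · refine key.trans (mul_le_mul_of_nonneg_left (Real.exp_le_exp.2 ?_) two_pos.le)
    have hterm : ∀ k ∈ Finset.range (K + 1), l * d k / b k * (H k + b k ^ 2 / 2) ≤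
        l * a / 2 * d k + l * (d k * Real.sqrt (2 * H k)) := by
      intro k _
      set r := Real.sqrt (2 * H k) with hr
      have hr0 : 0 ≤ r := Real.sqrt_nonneg _
      have hrsq : H k = r ^ 2 / 2 := by
        rw [hr, Real.sq_sqrt (by have := hH0 k; positivity)]; ring
      have hmain : r ^ 2 + b k ^ 2 ≤ b k * (a + 2 * r) := by
        rcases le_total r a with h | h
        · have : b k = a := max_eq_right h
          rw [this]; nlinarith
        · have : b k = r := max_eq_left h
          rw [this]; nlinarith
      rw [hrsq, div_mul_eq_mul_div, div_le_iff₀ (hb0 k)]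
      have := mul_le_mul_of_nonneg_left hmain (mul_pos hl (hd0 k)).le
      nlinarith
    have hs := Finset.sum_le_sum hterm
    rw [Finset.sum_add_distrib, ← Finset.mul_sum _ d, ← Finset.mul_sum _ (fun k => d k * Real.sqrt (2 * H k))] at hs
    have h1 : l * a / 2 * ∑ k ∈ Finset.range (K + 1), d k ≤
        l ^ 2 * ε₀ ^ 2 / (2 * (1 - θ) ^ 2) := by
      refine (mul_le_mul_of_nonneg_left hdsum (by positivity)).trans (le_of_eq ?_)
      rw [ha]; field_simp
    have h2 : ∑ k ∈ Finset.range (K + 1), d k * Real.sqrt (2 * H k) ≤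
        Real.sqrt 2 * B + ε₀ * Real.sqrt (2 * Real.log F.card) * θ ^ K := by
      rw [Finset.sum_range_succ]
      have e1 : d K * Real.sqrt (2 * H K) = ε₀ * Real.sqrt (2 * Real.log F.card) * θ ^ K := by
        simp only [hd, hH, hA, lt_irrefl, if_false]; ring
      rw [e1]
      have e2 : ∑ k ∈ Finset.range K, d k * Real.sqrt (2 * H k) = Real.sqrt 2 *
          ∑ k ∈ Finset.range K, ε₀ * θ ^ k * Real.sqrt (Real.log (S (k + 1)).card) := by
        rw [Finset.mul_sum]
        refine Finset.sum_congr rfl fun k hk => ?_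
        have hk' := Finset.mem_range.1 hk
        rw [Real.sqrt_mul two_pos.le]
        simp only [hd, hH, hA, if_pos hk']; ring
      rw [e2]
      have := mul_le_mul_of_nonneg_left hB (Real.sqrt_nonneg 2)
      linarith
    have h3 := mul_le_mul_of_nonneg_left h2 hl.le
    linarith
  · calc ∑ k ∈ Finset.range (K + 1), l * d k / b k
        ≤ ∑ k ∈ Finset.range (K + 1), l / a * d k := by
          refine Finset.sum_le_sum fun k _ => ?_
          rw [div_mul_eq_mul_div]
          exact div_le_div_of_nonneg_left (mul_pos hl (hd0 k)).le ha0 (le_max_right _ _)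
      _ = l / a * ∑ k ∈ Finset.range (K + 1), d k := by rw [Finset.mul_sum]
      _ ≤ l / a * (ε₀ / (1 - θ)) := mul_le_mul_of_nonneg_left hdsum (by positivity)
      _ = 1 := by rw [ha]; field_simp
  · intro k
    have := (hb0 k).ne'
    have := (hd0 k).ne'
    field_simp
  · intro k _ s hs
    have hsI := hAI k s hs
    have hbd : b k / d k * d k = b k := div_mul_cancel₀ _ (hd0 k).ne'
    rw [← hbd, hbd]
    by_cases hk : k = 0
    · subst hk
      obtain ⟨m, v, hmv⟩ := hgauss 1 (fun _ => s) (fun _ => 1)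
      simp only [Finset.univ_unique, Finset.sum_const, Finset.card_singleton, one_smul,
        one_mul] at hmv
      have := aux_gauss P (Y s) m v hmv (d 0) (b 0 / d 0) (by simpa [hd] using h0 s hsI)
      rw [hbd] at this
      simpa [hZ] using this
    · obtain ⟨m, v, hmv⟩ := hgauss 2 ![s, π k s] ![1, -1]
      have hfun : (fun ω => ∑ i : Fin 2, (![1, -1] : Fin 2 → ℝ) i *
          Y ((![s, π k s] : Fin 2 → ℝ) i) ω) = fun ω => Y s ω - Y (π k s) ω := by
        ext ω; simp [Fin.sum_univ_two]; ring
      rw [hfun] at hmv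
      have := aux_gauss P _ m v hmv (d k) (b k / d k) (hD k s hsI)
      rw [hbd] at this
      simpa [hZ, hk] using this
  · intro k _
    rw [hH]
    exact (Real.exp_log (by linarith [hcpos k])).ge
  · rintro ω ⟨t, ht, hut⟩
    obtain ⟨s, h1, h2, h3⟩ := aux_path T Y S π hS hπ K t (hF t ht)
    refine ⟨s, ?_, ?_⟩
    · intro k hk
      simp only [hA]
      split_ifs with h
      · exact h2 k h
      · have : k = K := by omega
        rw [this, h1]; exact ht
    · refine hut.le.trans ?_
      rw [h3 ω]
      exact Finset.abs_sum_le_sum_abs _ _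

lemma aux_sum (C g ν R ε₀ θ : ℝ) (hC : 0 < C) (hg : 0 < g) (hg1 : g < 1) (hν : 0 < ν) (hR : 0 ≤ R)
    (hε : 0 < ε₀) (hθ : 0 < θ) (hθ1 : θ < 1) (h : ℕ → ℝ)
    (hh : ∀ k, h k ≤ if ε₀ * θ ^ k ≤ ν then R + (C / (ε₀ * θ ^ k)) ^ g else 0) (K : ℕ) :
    ∑ k ∈ Finset.range K, ε₀ * θ ^ k * h (k + 1) ≤
      ν * (R + (1 - g)⁻¹ * (C / ν) ^ g) / (θ * (1 - θ)) := by
  have hθ' : 0 < 1 - θ := by linarith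
  have hg' : 0 < 1 - g := by linarith
  set e : ℕ → ℝ := fun k => ε₀ * θ ^ k with he
  have he0 : ∀ k, 0 < e k := fun k => by positivity
  set Φ : ℝ → ℝ := fun x => x * R + C ^ g * ((1 - g)⁻¹ * x ^ (1 - g)) with hΦ
  have hmono : ∀ x y, 0 ≤ x → x ≤ y → Φ x ≤ Φ y := by
    intro x y hx hxy
    have h1 : x ^ (1 - g) ≤ y ^ (1 - g) := Real.rpow_le_rpow hx hxy hg'.le
    simp only [hΦ]
    gcongr
  have hΦ0 : ∀ x, 0 ≤ x → 0 ≤ Φ x := fun x hx => by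
    simp only [hΦ]; positivity
  have hstep : ∀ k ∈ Finset.range K, ε₀ * θ ^ k * h (k + 1) * (θ * (1 - θ)) ≤
      Φ (min (e (k + 1)) ν) - Φ (min (e (k + 1 + 1)) ν) := by
    intro k _
    have hle : e (k + 1 + 1) ≤ e (k + 1) := by
      simp only [he]
      rw [pow_succ θ (k + 1)]
      have : 0 < ε₀ * θ ^ (k + 1) := by positivity
      nlinarith
    have e1 : ε₀ * θ ^ k * h (k + 1) * (θ * (1 - θ)) = (e (k + 1) - e (k + 1 + 1)) * h (k + 1) := by
      simp only [he]; ring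
    rw [e1]
    have hk := mul_le_mul_of_nonneg_left (hh (k + 1)) (sub_nonneg.2 hle)
    refine hk.trans ?_
    have hed : ε₀ * θ ^ (k + 1) = e (k + 1) := rfl
    rw [hed]
    by_cases hc : e (k + 1) ≤ ν
    · rw [if_pos hc, min_eq_left hc, min_eq_left (hle.trans hc)]
      have := aux_concave g _ _ hg hg1 (he0 (k + 1 + 1)) hle
      have h2 := mul_le_mul_of_nonneg_left this (Real.rpow_pos_of_pos hC g).le
      have h3 : (C / e (k + 1)) ^ g = C ^ g * e (k + 1) ^ (-g) := by
        rw [Real.div_rpow hC.le (he0 _).le, Real.rpow_neg (he0 _).le]; rfl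
      rw [h3]
      simp only [hΦ]
      nlinarith
    · rw [if_neg hc, mul_zero, sub_nonneg]
      exact hmono _ _ (le_min (he0 _).le hν.le) (min_le_min_right _ hle)
  have hs := Finset.sum_le_sum hstep
  rw [Finset.sum_range_sub' (fun k => Φ (min (e (k + 1)) ν)), ← Finset.sum_mul] at hs
  rw [le_div_iff₀ (by positivity)]
  refine hs.trans ?_
  have h1 := hΦ0 (min (e (K + 1)) ν) (le_min (he0 _).le hν.le)
  have h2 := hmono (min (e (0 + 1)) ν) ν (le_min (he0 _).le hν.le) (min_le_right _ _)
  have h3 : Φ ν = ν * (R + (1 - g)⁻¹ * (C / ν) ^ g) := by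
    simp only [hΦ]
    rw [Real.div_rpow hC.le hν.le, Real.rpow_sub hν, Real.rpow_one]
    ring
  linarith

/-- Tail bound for the supremum of a separable Gaussian process with a logarithmic
mean-square modulus of continuity `σ(ε) = C/ln^β(e^α + 1/ε)`. -/
theorem gaussian_sup_tail_bound
    {Ω : Type*} [MeasurableSpace Ω] (P : Measure Ω) [IsProbabilityMeasure P]
    (T : ℝ) (hT : 0 < T) (Y : ℝ → Ω → ℝ)
    (hgauss : IsGaussianProcess P Y)
    (hsep : DoobSeparableOn P Y (Set.Icc 0 T))
    (hbdd : BddAbove (Set.range fun t : Set.Icc (0 : ℝ) T =>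
      Real.sqrt (∫ ω, (Y t ω) ^ 2 ∂P)))
    (C α β : ℝ) (hC : 0 < C) (hα : 0 < α) (hβ : 1 / 2 < β)
    (hmod : ∀ ε : ℝ, 0 < ε → ∀ t ∈ Set.Icc (0 : ℝ) T, ∀ s ∈ Set.Icc (0 : ℝ) T,
      |t - s| ≤ ε → Real.sqrt (∫ ω, (Y t ω - Y s ω) ^ 2 ∂P) ≤
        C / (Real.log (Real.exp α + 1 / ε)) ^ β) :
    ∀ u : ℝ,
      let ε₀ : ℝ := ⨆ t : Set.Icc (0 : ℝ) T, Real.sqrt (∫ ω, (Y t ω) ^ 2 ∂P);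
      let ν : ℝ := min ε₀ (C / (Real.log (Real.exp α + 1 / (T / 2))) ^ β);
      let δ : ℝ := ν / Real.sqrt 2 *
        (Real.sqrt (Real.log (T + 1)) + (1 - 1 / (2 * β))⁻¹ * (C / ν) ^ (1 / (2 * β)));
      8 * δ < u →
        P {ω | u < ⨆ t : Set.Icc (0 : ℝ) T, |Y t ω|} ≤
          ENNReal.ofReal
            (2 * Real.exp (-(u - Real.sqrt (8 * u * δ)) ^ 2 / (2 * ε₀ ^ 2))) := by
  intro u ε₀ ν δ hu
  have hI0 : (0 : ℝ) ∈ Set.Icc (0 : ℝ) T := ⟨le_rfl, hT.le⟩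
  have h0 : ∀ t ∈ Set.Icc 0 T, Real.sqrt (∫ ω, (Y t ω) ^ 2 ∂P) ≤ ε₀ := by
    intro t ht
    exact le_ciSup hbdd (⟨t, ht⟩ : Set.Icc (0 : ℝ) T)
  have hε0 : 0 ≤ ε₀ := (Real.sqrt_nonneg _).trans (h0 0 hI0)
  rcases hε0.eq_or_lt with hz | hε
  · rw [← hz]
    refine prob_le_one.trans ?_
    rw [← ENNReal.ofReal_one]
    apply ENNReal.ofReal_le_ofReal
    norm_num
  have hβ0 : 0 < β := by linarith
  set g := 1 / (2 * β) with hg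
  have hg0 : 0 < g := by positivity
  have hg1 : g < 1 := by rw [hg, div_lt_one (by positivity)]; linarith
  set σ := C / (Real.log (Real.exp α + 1 / (T / 2))) ^ β with hσ
  have hσ0 : 0 < σ := by
    have : 0 < Real.log (Real.exp α + 1 / (T / 2)) := by
      apply Real.log_pos
      have := Real.one_lt_exp_iff.2 hα
      have : 0 < 1 / (T / 2) := by positivity
      linarith
    positivity
  have hν0 : 0 < ν := lt_min hε hσ0
  have hg' : 0 < 1 - g := by linarith
  have hδ0 : 0 < δ := by
    have : 0 < (C / ν) ^ g := by positivity
    have h2 : 0 < (1 - g)⁻¹ * (C / ν) ^ g := by positivity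
    have h3 := Real.sqrt_nonneg (Real.log (T + 1))
    exact mul_pos (by positivity) (by linarith)
  have hu0 : 0 < u := by linarith
  set θ := Real.sqrt (2 * δ / u) with hθdef
  have hθ : 0 < θ := Real.sqrt_pos.2 (by positivity)
  have hθsq : θ ^ 2 * u = 2 * δ := by
    rw [hθdef, Real.sq_sqrt (by positivity)]; field_simp
  have hθ2 : θ < 1 / 2 := by
    by_contra hcon
    push Not at hcon
    have : 1 / 4 ≤ θ ^ 2 := by nlinarith
    nlinarith
  have hsq : Real.sqrt (8 * u * δ) = 2 * θ * u := by
    rw [Real.sqrt_eq_iff_mul_self_eq (by positivity) (by positivity)]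
    nlinarith
  rw [hsq]
  have hnets : ∀ k : ℕ, ∃ (S : Finset ℝ) (π : ℝ → ℝ), S.Nonempty ∧ (∀ s ∈ S, s ∈ Set.Icc 0 T) ∧
      (∀ t ∈ Set.Icc 0 T, π t ∈ S ∧
        Real.sqrt (∫ ω, (Y t ω - Y (π t) ω) ^ 2 ∂P) ≤ ε₀ * θ ^ k) ∧
      Real.sqrt (Real.log S.card) ≤ if ε₀ * θ ^ k ≤ ν then
        Real.sqrt (Real.log (T + 1)) + (C / (ε₀ * θ ^ k)) ^ (1 / (2 * β)) else 0 := by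
    intro k
    refine aux_net T hT (fun t s => Real.sqrt (∫ ω, (Y t ω - Y s ω) ^ 2 ∂P)) C α β hC hα hβ hmod
      ν (ε₀ * θ ^ k) (by positivity) (min_le_right _ _) ?_
    intro h
    have h1 : ε₀ * θ ^ k ≤ ε₀ :=
      mul_le_of_le_one_right hε.le (pow_le_one₀ hθ.le (by linarith))
    rcases min_lt_iff.1 h with h2 | h2
    · linarith
    · exact h2.le
  choose S π hne hS hπD hH using hnets
  have hB := aux_sum C g ν (Real.sqrt (Real.log (T + 1))) ε₀ θ hC hg0 hg1 hν0 (Real.sqrt_nonneg _)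
    hε hθ (by linarith) _ hH
  set Φ := ν * (Real.sqrt (Real.log (T + 1)) + (1 - g)⁻¹ * (C / ν) ^ g) with hΦ
  have hΦδ : Real.sqrt 2 * Φ = 2 * δ := by
    have h2 : δ = Φ / Real.sqrt 2 := by
      show ν / Real.sqrt 2 * _ = _
      rw [hΦ]; ring
    rw [h2]
    have := Real.sq_sqrt (two_pos (α := ℝ)).le
    field_simp
    rw [this]; ring
  set l := (1 - θ) * (u * (1 - 2 * θ)) / ε₀ ^ 2 with hldef
  have h1θ : 0 < 1 - θ := by linarith
  have h12θ : 0 < 1 - 2 * θ := by linarith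
  have hl : 0 < l := by positivity
  have hexp : l ^ 2 * ε₀ ^ 2 / (2 * (1 - θ) ^ 2) + Real.sqrt 2 * l * (Φ / (θ * (1 - θ))) - l * u =
      -(u - 2 * θ * u) ^ 2 / (2 * ε₀ ^ 2) := by
    have h2 : Real.sqrt 2 * l * (Φ / (θ * (1 - θ))) = l * (θ * u) / (1 - θ) := by
      rw [show Real.sqrt 2 * l * (Φ / (θ * (1 - θ))) =
        l * (Real.sqrt 2 * Φ) / (θ * (1 - θ)) by ring, hΦδ, ← hθsq]
      field_simp
    rw [h2, hldef]
    field_simp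
    ring
  have hfin : ∀ F : Finset ℝ, F.Nonempty → (∀ t ∈ F, t ∈ Set.Icc 0 T) →
      P {ω | ∃ t ∈ F, u < |Y t ω|} ≤
        ENNReal.ofReal (2 * Real.exp (-(u - 2 * θ * u) ^ 2 / (2 * ε₀ ^ 2))) := by
    intro F hFne hF
    have hb : ∀ K : ℕ, P.real {ω | ∃ t ∈ F, u < |Y t ω|} ≤
        2 * Real.exp (-(u - 2 * θ * u) ^ 2 / (2 * ε₀ ^ 2) +
          l * (ε₀ * Real.sqrt (2 * Real.log F.card)) * θ ^ K) := by
      intro K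
      have := aux_core P T Y hgauss S π ε₀ θ l u _ hε hθ (by linarith) hl hne hS
        (fun k t ht => (hπD k t ht).1) h0 (fun k t ht => (hπD k t ht).2) F hF hFne K (hB K)
      rwa [hexp] at this
    have hlim : Tendsto (fun K : ℕ => 2 * Real.exp (-(u - 2 * θ * u) ^ 2 / (2 * ε₀ ^ 2) +
        l * (ε₀ * Real.sqrt (2 * Real.log F.card)) * θ ^ K)) atTop
        (nhds (2 * Real.exp (-(u - 2 * θ * u) ^ 2 / (2 * ε₀ ^ 2) +
          l * (ε₀ * Real.sqrt (2 * Real.log F.card)) * 0))) :=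
      ((Real.continuous_exp.tendsto _).comp
        (((tendsto_pow_atTop_nhds_zero_of_lt_one hθ.le (by linarith)).const_mul _).const_add
          _)).const_mul _
    have := ge_of_tendsto' hlim hb
    rw [mul_zero, add_zero] at this
    rw [← ENNReal.ofReal_toReal (measure_ne_top P _)]
    exact ENNReal.ofReal_le_ofReal this
  obtain ⟨Q, hQc, hQI, hQ⟩ := hsep
  have hQne : Q.Nonempty := by
    obtain ⟨ω, hω⟩ := hQ.exists
    have := hω 0 hI0 1 one_pos
    by_contra hcon
    rw [Set.not_nonempty_iff_eq_empty] at hcon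
    simp [hcon] at this
  obtain ⟨f, hf⟩ := hQc.exists_eq_range hQne
  have hle : P {ω | u < ⨆ t : Set.Icc (0 : ℝ) T, |Y t ω|} ≤ P (⋃ n, {ω | u < |Y (f n) ω|}) := by
    apply measure_mono_ae
    filter_upwards [hQ] with ω hω hlt
    have hlt' : u < ⨆ t : Set.Icc (0 : ℝ) T, |Y t ω| := hlt
    haveI : Nonempty (Set.Icc (0 : ℝ) T) := ⟨⟨0, hI0⟩⟩
    obtain ⟨t, ht⟩ := exists_lt_of_lt_ciSup hlt'
    have hcl := hω t t.2 1 one_pos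
    have hopen : IsOpen {x : ℝ | u < |x|} := isOpen_lt continuous_const continuous_abs
    obtain ⟨x, hx, s, hs, rfl⟩ := mem_closure_iff.1 hcl _ hopen ht
    have hsQ := hs.1
    rw [hf] at hsQ
    obtain ⟨n, rfl⟩ := hsQ
    exact Set.mem_iUnion.2 ⟨n, hx⟩
  refine hle.trans ?_
  rw [measure_iUnion_eq_iSup_accumulate]
  refine iSup_le fun n => ?_
  refine le_trans (measure_mono ?_) (hfin ((Finset.range (n + 1)).image f) (by simp) ?_)
  · intro ω hω
    obtain ⟨i, hi, hx⟩ := Set.mem_accumulate.1 hω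
    exact ⟨f i, Finset.mem_image.2 ⟨i, Finset.mem_range.2 (by omega), rfl⟩, hx⟩
  · intro t ht
    obtain ⟨i, _, rfl⟩ := Finset.mem_image.1 ht
    exact hQI (hf ▸ Set.mem_range_self i)
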